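/- arXiv:1907.01437 — 2 statements merged into one kernel-verified Lean document; each statement's English description precedes it below -/
import Mathlib

section
/- Let γ > β > 0. There is a constant C = C(β,γ) > 0 (for instance C² = 2(2 + (1 + β²/2)/(γ(γ−β))) works) such that for every h lying in H_γ with weak derivative g and with h(∞) := lim_{x→∞} h(x) = 0, the reflected function F : ℝ → ℝ, F(x) = h(|x|) e^{(β/2)|x|}, satisfies F(x) = h(0) + ∫₀ˣ sgn(t)(g(|t|) + (β/2) h(|t|)) e^{(β/2)|t|} dt for all x ∈ ℝ, and ∫_ℝ |h(|x|)|² e^{β|x|} dx + ∫_ℝ |(g(|x|) + (β/2) h(|x|)) e^{(β/2)|x|}|² dx ≤ C² ‖h‖_γ². In particular F belongs to W¹(ℝ) with ‖F‖_{W¹(ℝ)} ≤ C ‖h‖_γ. -/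
open MeasureTheory Real Filter Set

/-- A function with finite exponentially weighted `L²` norm on `(0, ∞)` is integrable there. -/
lemma integrableOn_Ioi_of_sq_mul_exp {γ : ℝ} (hγ : 0 < γ) {g : ℝ → ℝ} (hg : Measurable g)
    (hg_int : IntegrableOn (fun t => g t ^ 2 * exp (γ * t)) (Ioi 0)) :
    IntegrableOn g (Ioi 0) := by
  refine (hg_int.add (integrableOn_exp_mul_Ioi (neg_lt_zero.mpr hγ) 0)).mono'
    hg.aestronglyMeasurable (ae_of_all _ fun t => ?_)
  have hexp : exp (γ * t) * exp (-γ * t) = 1 := by rw [← exp_add]; simp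
  have hsq : 0 ≤ exp (γ * t) * (|g t| - exp (-γ * t)) ^ 2 := by positivity
  have hexpand : exp (γ * t) * (|g t| - exp (-γ * t)) ^ 2
      = g t ^ 2 * exp (γ * t) - 2 * |g t| + exp (-γ * t) := by
    rw [← sq_abs (g t)]
    linear_combination (-2 * |g t| + exp (-γ * t)) * hexp
  simp only [Pi.add_apply, Real.norm_eq_abs]
  linarith [abs_nonneg (g t)]

/-- The Cauchy–Schwarz tail bound `(∫ₓ^∞ g)² ≤ (e^{-γx}/γ) ∫₀^∞ g² e^{γt} dt`. -/
lemma sq_integral_Ioi_le_exp_mul {γ : ℝ} (hγ : 0 < γ) {g : ℝ → ℝ} (hg : Measurable g)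
    (hg_int : IntegrableOn (fun t => g t ^ 2 * exp (γ * t)) (Ioi 0)) {x : ℝ} (hx : 0 ≤ x) :
    (∫ t in Ioi x, g t) ^ 2
      ≤ (∫ t in Ioi (0 : ℝ), g t ^ 2 * exp (γ * t)) / γ * exp (-γ * x) := by
  have hsub : Ioi x ⊆ Ioi 0 := Ioi_subset_Ioi hx
  have hI := (integrableOn_Ioi_of_sq_mul_exp hγ hg hg_int).mono_set hsub
  have hN := hg_int.mono_set hsub
  have hE := integrableOn_exp_mul_Ioi (neg_lt_zero.mpr hγ) x
  have hmono : ∫ t in Ioi x, g t ^ 2 * exp (γ * t) ≤ ∫ t in Ioi (0 : ℝ), g t ^ 2 * exp (γ * t) :=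
    setIntegral_mono_set hg_int (ae_of_all _ fun t => by positivity) hsub.eventuallyLE
  have hpoly (c : ℝ) : 0 ≤ (∫ t in Ioi x, g t ^ 2 * exp (γ * t)) - 2 * c * (∫ t in Ioi x, g t)
      + c ^ 2 * (exp (-γ * x) / γ) := by
    have hK : ∫ t in Ioi x, exp (-γ * t) = exp (-γ * x) / γ := by
      rw [integral_exp_mul_Ioi (neg_lt_zero.mpr hγ), neg_div_neg_eq]
    rw [← hK, ← integral_const_mul, ← integral_const_mul,
      ← integral_sub hN (hI.const_mul _),
      ← integral_add (by exact hN.sub (hI.const_mul _)) (hE.const_mul _)]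
    refine integral_nonneg fun t => ?_
    have hexp : exp (γ * t) * exp (-γ * t) = 1 := by rw [← exp_add]; simp
    have hsq : 0 ≤ exp (γ * t) * (g t - c * exp (-γ * t)) ^ 2 := by positivity
    have hexpand : exp (γ * t) * (g t - c * exp (-γ * t)) ^ 2
        = g t ^ 2 * exp (γ * t) - 2 * c * g t + c ^ 2 * exp (-γ * t) := by
      linear_combination (-2 * c * g t + c ^ 2 * exp (-γ * t)) * hexp
    simpa only [Pi.zero_apply, hexpand] using hsq
  have hKpos : 0 < exp (-γ * x) / γ := by positivity
  have hmin := hpoly ((∫ t in Ioi x, g t) / (exp (-γ * x) / γ))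
  set I := ∫ t in Ioi x, g t
  set K := exp (-γ * x) / γ
  have heq : (∫ t in Ioi x, g t ^ 2 * exp (γ * t)) - 2 * (I / K) * I + (I / K) ^ 2 * K
      = (∫ t in Ioi x, g t ^ 2 * exp (γ * t)) - I ^ 2 / K := by
    field_simp
    ring
  rw [heq, sub_nonneg, div_le_iff₀ hKpos] at hmin
  calc I ^ 2 ≤ _ := hmin
    _ ≤ (∫ t in Ioi (0 : ℝ), g t ^ 2 * exp (γ * t)) * K := by gcongr
    _ = _ := by ring

/-- The product rule in integral form for a primitive times an exponential. -/
lemma primitive_mul_exp_eq {g : ℝ → ℝ} {c a x : ℝ} (hg : IntervalIntegrable g volume 0 x) :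
    (c + ∫ t in (0 : ℝ)..x, g t) * exp (a * x)
      = c + ∫ t in (0 : ℝ)..x, (g t + a * (c + ∫ s in (0 : ℝ)..t, g s)) * exp (a * t) := by
  have hF : AbsolutelyContinuousOnInterval (fun t => c + ∫ s in (0 : ℝ)..t, g s) 0 x :=
    (contDiffOn_const (c := c)).absolutelyContinuousOnInterval.fun_add
      (hg.absolutelyContinuousOnInterval_intervalIntegral left_mem_uIcc)
  have hE : AbsolutelyContinuousOnInterval (fun t => exp (a * t)) 0 x :=
    ContDiffOn.absolutelyContinuousOnInterval (by fun_prop)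
  have hparts := hF.integral_deriv_mul_eq_sub hE
  simp only [intervalIntegral.integral_same, mul_zero, exp_zero, add_zero, mul_one] at hparts
  rw [eq_add_of_sub_eq' hparts.symm]
  congr 1
  refine intervalIntegral.integral_congr_ae ?_
  filter_upwards [hg.ae_hasDerivAt_integral] with t ht htx
  have hd := ((ht (uIoc_subset_uIcc htx) 0 left_mem_uIcc).const_add c).deriv
  have he : HasDerivAt (fun t => exp (a * t)) (exp (a * t) * a) t := by
    simpa using ((hasDerivAt_id t).const_mul a).exp
  rw [hd, he.deriv]
  ring

/-- The signed integral of an even function over `[0, x]` is its integral over `[0, |x|]`. -/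
lemma intervalIntegral_sign_mul_comp_abs (k : ℝ → ℝ) (x : ℝ) :
    ∫ t in (0 : ℝ)..x, Real.sign t * k |t| = ∫ t in (0 : ℝ)..|x|, k t := by
  have hpos {y : ℝ} (hy : 0 ≤ y) :
      ∫ t in (0 : ℝ)..y, Real.sign t * k |t| = ∫ t in (0 : ℝ)..y, k t := by
    refine intervalIntegral.integral_congr_ae (ae_of_all _ fun t ht => ?_)
    rw [uIoc_of_le hy] at ht
    rw [Real.sign_of_pos ht.1, abs_of_pos ht.1, one_mul]
  rcases le_total 0 x with hx | hx
  · rw [abs_of_nonneg hx, hpos hx]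
  · rw [abs_of_nonpos hx, ← hpos (neg_nonneg.mpr hx)]
    have := intervalIntegral.integral_comp_neg (a := 0) (b := -x)
      fun t => Real.sign t * k |t|
    simp only [neg_neg, neg_zero, abs_neg, Real.sign_neg, neg_mul,
      intervalIntegral.integral_neg] at this
    rw [intervalIntegral.integral_symm, ← this, neg_neg]

/-- Even reflection preserves integrability. -/
lemma integrable_comp_abs {f : ℝ → ℝ} (hf : IntegrableOn f (Ioi 0)) :
    Integrable fun x => f |x| := by
  have hpos : IntegrableOn (fun x => f |x|) (Ioi 0) :=
    hf.congr_fun (fun x hx => by rw [abs_of_pos hx]) measurableSet_Ioi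
  have hneg : IntegrableOn (fun x => f |x|) (Iic 0) := by
    rw [← neg_zero] at hpos
    simpa using (Iff.mpr integrableOn_Ici_iff_integrableOn_Ioi hpos).comp_neg_Iic
  rw [← integrableOn_univ, ← Iic_union_Ioi (a := (0 : ℝ))]
  exact hneg.union hpos

open MeasureTheory Real Filter Set

/-- If `γ > β > 0` and `h` lies in `H_γ` with weak derivative `g` and `h(∞) = 0`, then the
reflected function `F(x) = h(|x|) e^{(β/2)|x|}` belongs to `W¹(ℝ)`, with
`‖F‖_{W¹(ℝ)} ≤ C ‖h‖_γ` for the constant `C = C(β,γ) > 0` given by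
`C² = 2(2 + (1 + β²/2)/(γ(γ-β)))`. -/
theorem reflection_bound_W1_R
    (β γ : ℝ) (hβ : 0 < β) (hβγ : β < γ) (h g : ℝ → ℝ)
    (hg_meas : Measurable g)
    (hg_int : IntegrableOn (fun t => g t ^ 2 * Real.exp (γ * t)) (Set.Ioi 0))
    (hFTC : ∀ x ≥ (0 : ℝ), h x = h 0 + ∫ t in (0:ℝ)..x, g t)
    (hlim : Tendsto h atTop (nhds 0)) :
    (0 : ℝ) < Real.sqrt (2 * (2 + (1 + β ^ 2 / 2) / (γ * (γ - β)))) ∧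
    (∀ x : ℝ, h |x| * Real.exp (β / 2 * |x|)
        = h 0 + ∫ t in (0:ℝ)..x,
            Real.sign t * ((g |t| + β / 2 * h |t|) * Real.exp (β / 2 * |t|))) ∧
      Integrable (fun x : ℝ => h |x| ^ 2 * Real.exp (β * |x|)) ∧
      Integrable (fun x : ℝ => ((g |x| + β / 2 * h |x|) * Real.exp (β / 2 * |x|)) ^ 2) ∧
      (∫ x : ℝ, h |x| ^ 2 * Real.exp (β * |x|))
          + (∫ x : ℝ, ((g |x| + β / 2 * h |x|) * Real.exp (β / 2 * |x|)) ^ 2)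
        ≤ (2 * (2 + (1 + β ^ 2 / 2) / (γ * (γ - β)))) *
            (|h 0| ^ 2 + ∫ t in Set.Ioi (0:ℝ), g t ^ 2 * Real.exp (γ * t)) ∧
      Real.sqrt ((∫ x : ℝ, h |x| ^ 2 * Real.exp (β * |x|))
          + ∫ x : ℝ, ((g |x| + β / 2 * h |x|) * Real.exp (β / 2 * |x|)) ^ 2)
        ≤ Real.sqrt (2 * (2 + (1 + β ^ 2 / 2) / (γ * (γ - β)))) *
            Real.sqrt (|h 0| ^ 2 + ∫ t in Set.Ioi (0:ℝ), g t ^ 2 * Real.exp (γ * t)) := by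
  have hγ : 0 < γ := hβ.trans hβγ
  have hγβ : 0 < γ - β := sub_pos.mpr hβγ
  have hgi := integrableOn_Ioi_of_sq_mul_exp hγ hg_meas hg_int
  have hgii {x : ℝ} (hx : 0 ≤ x) : IntervalIntegrable g volume 0 x :=
    (intervalIntegrable_iff_integrableOn_Ioc_of_le hx).mpr (hgi.mono_set Ioc_subset_Ioi_self)
  have htail {x : ℝ} (hx : 0 ≤ x) : h x = -∫ t in Ioi x, g t := by
    have hgx : IntegrableOn g (Ioi x) := hgi.mono_set (Ioi_subset_Ioi hx)
    have hT := (intervalIntegral_tendsto_integral_Ioi x hgx tendsto_id).const_add (h x)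
    have hT' : Tendsto (fun y => h x + ∫ t in x..id y, g t) atTop (nhds 0) := by
      refine hlim.congr' ?_
      filter_upwards [eventually_ge_atTop x] with y hy
      rw [hFTC y (hx.trans hy), hFTC x hx, add_assoc, id,
        intervalIntegral.integral_add_adjacent_intervals (hgii hx)
          ((hgii hx).symm.trans (hgii (hx.trans hy)))]
    linarith [tendsto_nhds_unique hT hT']
  have hh_meas : AEStronglyMeasurable h (volume.restrict (Ioi 0)) := by
    refine ContinuousOn.aestronglyMeasurable (fun x hx => ?_) measurableSet_Ioi
    have hx1 : (0 : ℝ) ≤ x + 1 := by linarith [mem_Ioi.mp hx]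
    have hc := ((hgii hx1).absolutelyContinuousOnInterval_intervalIntegral
      left_mem_uIcc).continuousOn
    rw [uIcc_of_le hx1] at hc
    have hcx := (hc.continuousAt (Icc_mem_nhds hx (lt_add_one x))).const_add (h 0)
    refine (hcx.congr ?_).continuousWithinAt
    filter_upwards [Ioi_mem_nhds hx] with y hy
    exact (hFTC y (le_of_lt hy)).symm
  set N := ∫ t in Ioi (0 : ℝ), g t ^ 2 * exp (γ * t) with hN
  have hN0 : 0 ≤ N := integral_nonneg fun t => by positivity
  have hh_le {x : ℝ} (hx : 0 ≤ x) :
      h x ^ 2 * exp (β * x) ≤ N / γ * exp (-(γ - β) * x) := by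
    rw [htail hx, neg_sq]
    calc _ ≤ N / γ * exp (-γ * x) * exp (β * x) := by
          gcongr
          exact sq_integral_Ioi_le_exp_mul hγ hg_meas hg_int hx
      _ = _ := by rw [mul_assoc, ← exp_add]; ring_nf
  have hmaj := (integrableOn_exp_mul_Ioi (neg_lt_zero.mpr hγβ) 0).const_mul (N / γ)
  have hh_int : IntegrableOn (fun x => h x ^ 2 * exp (β * x)) (Ioi 0) := by
    refine hmaj.mono' ((hh_meas.pow 2).mul (by fun_prop)) ?_
    filter_upwards [ae_restrict_mem measurableSet_Ioi] with x hx
    rw [Real.norm_of_nonneg (by positivity)]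
    exact hh_le (le_of_lt hx)
  have hh_bound : ∫ x in Ioi (0 : ℝ), h x ^ 2 * exp (β * x) ≤ N / (γ * (γ - β)) := by
    calc _ ≤ ∫ x in Ioi (0 : ℝ), N / γ * exp (-(γ - β) * x) :=
          setIntegral_mono_on hh_int hmaj measurableSet_Ioi fun x hx => hh_le (le_of_lt hx)
      _ = _ := by
          rw [integral_const_mul, integral_exp_mul_Ioi (neg_lt_zero.mpr hγβ), mul_zero, exp_zero,
            neg_div_neg_eq]
          field_simp
  have hk_le {x : ℝ} (hx : 0 ≤ x) : ((g x + β / 2 * h x) * exp (β / 2 * x)) ^ 2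
      ≤ 2 * (g x ^ 2 * exp (γ * x)) + β ^ 2 / 2 * (h x ^ 2 * exp (β * x)) := by
    have hexp : exp (β / 2 * x) ^ 2 = exp (β * x) := by rw [← exp_nat_mul]; ring_nf
    have hle : exp (β * x) ≤ exp (γ * x) := by gcongr
    rw [mul_pow, hexp]
    calc _ ≤ (2 * g x ^ 2 + β ^ 2 / 2 * h x ^ 2) * exp (β * x) := by
          gcongr
          nlinarith [sq_nonneg (g x - β / 2 * h x)]
      _ = 2 * (g x ^ 2 * exp (β * x)) + β ^ 2 / 2 * (h x ^ 2 * exp (β * x)) := by ring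
      _ ≤ _ := by gcongr
  have hmaj' := (hg_int.const_mul 2).add (hh_int.const_mul (β ^ 2 / 2))
  have hk_int : IntegrableOn (fun x => ((g x + β / 2 * h x) * exp (β / 2 * x)) ^ 2) (Ioi 0) := by
    refine hmaj'.mono' (((hg_meas.aestronglyMeasurable.add (hh_meas.const_mul _)).mul
      (by fun_prop)).pow 2) ?_
    filter_upwards [ae_restrict_mem measurableSet_Ioi] with x hx
    rw [Real.norm_of_nonneg (by positivity)]
    exact hk_le (le_of_lt hx)
  have hk_bound : ∫ x in Ioi (0 : ℝ), ((g x + β / 2 * h x) * exp (β / 2 * x)) ^ 2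
      ≤ 2 * N + β ^ 2 / 2 * (∫ x in Ioi (0 : ℝ), h x ^ 2 * exp (β * x)) := by
    rw [hN, ← integral_const_mul, ← integral_const_mul,
      ← integral_add (hg_int.const_mul 2) (hh_int.const_mul _)]
    exact setIntegral_mono_on hk_int hmaj' measurableSet_Ioi fun x hx => hk_le (le_of_lt hx)
  have hC : 0 < 2 * (2 + (1 + β ^ 2 / 2) / (γ * (γ - β))) := by positivity
  have hnorm : (∫ x : ℝ, h |x| ^ 2 * exp (β * |x|))
        + (∫ x : ℝ, ((g |x| + β / 2 * h |x|) * exp (β / 2 * |x|)) ^ 2)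
      ≤ (2 * (2 + (1 + β ^ 2 / 2) / (γ * (γ - β)))) * (|h 0| ^ 2 + N) := by
    rw [integral_comp_abs (f := fun x => h x ^ 2 * exp (β * x)),
      integral_comp_abs (f := fun x => ((g x + β / 2 * h x) * exp (β / 2 * x)) ^ 2)]
    calc _ ≤ 4 * N + (2 + β ^ 2) * ∫ x in Ioi (0 : ℝ), h x ^ 2 * exp (β * x) := by
          linarith [hk_bound]
      _ ≤ 4 * N + (2 + β ^ 2) * (N / (γ * (γ - β))) := by gcongr
      _ = (2 * (2 + (1 + β ^ 2 / 2) / (γ * (γ - β)))) * N := by ring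
      _ ≤ _ := by gcongr; exact le_add_of_nonneg_left (by positivity)
  refine ⟨Real.sqrt_pos.mpr hC, fun x => ?_, integrable_comp_abs hh_int,
    integrable_comp_abs hk_int, hnorm, ?_⟩
  · rw [intervalIntegral_sign_mul_comp_abs fun t => (g t + β / 2 * h t) * exp (β / 2 * t),
      hFTC _ (abs_nonneg x), primitive_mul_exp_eq (hgii (abs_nonneg x))]
    congr 1
    refine intervalIntegral.integral_congr fun t ht => ?_
    rw [uIcc_of_le (abs_nonneg x)] at ht
    simp only [← hFTC t ht.1]
  · rw [← Real.sqrt_mul hC.le]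
    exact Real.sqrt_le_sqrt hnorm
end

section
/- Let γ > β > 0 and let h lie in H_γ with weak derivative g and with h(∞) := lim_{x→∞} h(x) = 0. Then ∫₀^∞ |h(x)|² e^{βx} dx ≤ ∫_ℝ |(𝓕F)(ξ)|² dξ, where F : ℝ → ℝ is the even reflection F(x) = h(|x|) e^{(β/2)|x|} (which lies in L¹(ℝ) ∩ L²(ℝ)) and 𝓕F is its Fourier transform. -/
open MeasureTheory Real Filter Set Complex

open scoped FourierTransform SchwartzMap ContDiff

/-- The `L²`-Fourier transform of an integrable square-integrable function is represented by
its Fourier integral. -/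
theorem coeFn_fourier_toLp_ae_eq {f : ℝ → ℂ} (h1 : Integrable f) (h2 : MemLp f 2) :
    ((𝓕 (h2.toLp f) : Lp (α := ℝ) ℂ 2 volume) : ℝ → ℂ) =ᵐ[volume] 𝓕 f := by
  have hcont : Continuous (𝓕 f) :=
    VectorFourier.fourierIntegral_continuous (L := innerₗ ℝ) Real.continuous_fourierChar
      continuous_inner h1
  refine ae_eq_of_integral_contDiff_smul_eq
    ((Lp.memLp _).locallyIntegrable (by norm_num)) hcont.locallyIntegrable fun φ hφ hφc => ?_
  have hs : HasCompactSupport (Complex.ofRealCLM ∘ φ) := hφc.comp_left rfl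
  have hd : ContDiff ℝ ∞ (Complex.ofRealCLM ∘ φ) := by fun_prop
  set s : 𝓢(ℝ, ℂ) := hs.toSchwartzMap hd
  have hflip : ∫ ξ, (𝓕 (s : ℝ → ℂ)) ξ • f ξ = ∫ x, s x • 𝓕 f x := by
    simpa using! VectorFourier.integral_fourierIntegral_smul_eq_flip (L := innerₗ ℝ)
      Real.continuous_fourierChar continuous_inner s.integrable h1
  calc ∫ x, φ x • (𝓕 (h2.toLp f) : Lp (α := ℝ) ℂ 2 volume) x
      = Lp.toTemperedDistribution (𝓕 (h2.toLp f)) s := by simp [s]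
    _ = Lp.toTemperedDistribution (h2.toLp f) (𝓕 s) := by
      rw [← Lp.fourier_toTemperedDistribution_eq, TemperedDistribution.fourier_apply]
    _ = ∫ ξ, (𝓕 (s : ℝ → ℂ)) ξ • f ξ := by
      rw [Lp.toTemperedDistribution_apply]
      refine integral_congr_ae ?_
      filter_upwards [h2.coeFn_toLp] with x hx
      rw [hx, SchwartzMap.fourier_coe]
    _ = ∫ x, φ x • 𝓕 f x := by rw [hflip]; simp [s]

theorem integral_norm_sq_eq_norm_sq_Lp (u : Lp (α := ℝ) ℂ 2 volume) :
    ∫ x, ‖u x‖ ^ 2 = ‖u‖ ^ 2 := by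
  have h := L2.inner_def (𝕜 := ℂ) u u
  simp_rw [inner_self_eq_norm_sq_to_K] at h
  norm_cast at h
  exact h.symm

/-- Plancherel's identity for integrable square-integrable functions. -/
theorem integral_norm_sq_fourier_eq {f : ℝ → ℂ} (h1 : Integrable f) (h2 : MemLp f 2) :
    ∫ ξ, ‖𝓕 f ξ‖ ^ 2 = ∫ x, ‖f x‖ ^ 2 := by
  calc ∫ ξ, ‖𝓕 f ξ‖ ^ 2 = ∫ ξ, ‖(𝓕 (h2.toLp f) : Lp (α := ℝ) ℂ 2 volume) ξ‖ ^ 2 := by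
        refine integral_congr_ae ?_
        filter_upwards [coeFn_fourier_toLp_ae_eq h1 h2] with x hx
        rw [hx]
    _ = ∫ x, ‖h2.toLp f x‖ ^ 2 := by
        rw [integral_norm_sq_eq_norm_sq_Lp, integral_norm_sq_eq_norm_sq_Lp, Lp.norm_fourier_eq]
    _ = ∫ x, ‖f x‖ ^ 2 := by
        refine integral_congr_ae ?_
        filter_upwards [h2.coeFn_toLp] with x hx
        rw [hx]

/-- Plancherel's identity for the unitary Fourier transform in angular frequency. -/
theorem integral_norm_sq_unitary_fourier_eq {f : ℝ → ℂ} (h1 : Integrable f) (h2 : MemLp f 2) :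
    ∫ ξ : ℝ, ‖((Real.sqrt (2 * Real.pi) : ℂ))⁻¹ *
        ∫ x : ℝ, f x * Complex.exp (-(Complex.I * ξ * x))‖ ^ 2 = ∫ x, ‖f x‖ ^ 2 := by
  have hpt (ξ : ℝ) : ‖((Real.sqrt (2 * Real.pi) : ℂ))⁻¹ *
      ∫ x : ℝ, f x * Complex.exp (-(Complex.I * ξ * x))‖ ^ 2 =
      (2 * π)⁻¹ * ‖𝓕 f (ξ / (2 * π))‖ ^ 2 := by
    have hF : ∫ x : ℝ, f x * Complex.exp (-(Complex.I * ξ * x)) = 𝓕 f (ξ / (2 * π)) := by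
      rw [Real.fourier_real_eq_integral_exp_smul]
      refine integral_congr_ae (Eventually.of_forall fun x => ?_)
      have hexp : -(Complex.I * ξ * x) = ↑(-2 * π * x * (ξ / (2 * π))) * Complex.I := by
        have : (π : ℂ) ≠ 0 := by exact_mod_cast Real.pi_ne_zero
        push_cast
        field_simp
      simp only [smul_eq_mul]
      rw [hexp, mul_comm]
    rw [hF, norm_mul, mul_pow, norm_inv, Complex.norm_real, inv_pow, Real.norm_eq_abs, sq_abs,
      Real.sq_sqrt (by positivity)]
  simp_rw [hpt]
  rw [integral_const_mul, Measure.integral_comp_div (fun ξ => ‖𝓕 f ξ‖ ^ 2) (2 * π),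
    integral_norm_sq_fourier_eq h1 h2, abs_of_pos (by positivity), smul_eq_mul,
    inv_mul_cancel_left₀ (by positivity)]

theorem integrable_exp_neg_mul_abs {c : ℝ} (hc : 0 < c) :
    Integrable fun x : ℝ => Real.exp (-c * |x|) := by
  rw [← integrableOn_univ, ← Iic_union_Ioi (a := (0 : ℝ))]
  refine IntegrableOn.union ?_ ?_
  · refine (integrableOn_exp_mul_Iic hc 0).congr_fun (fun x hx => ?_) measurableSet_Iic
    simp [abs_of_nonpos (mem_Iic.1 hx)]
  · refine (integrableOn_exp_mul_Ioi (neg_lt_zero.2 hc) 0).congr_fun (fun x hx => ?_)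
      measurableSet_Ioi
    simp [abs_of_pos (mem_Ioi.1 hx)]

theorem abs_le_weighted_sq_add_exp (γ x t a : ℝ) :
    |a| ≤ Real.exp (-(γ / 2 * x)) * (a ^ 2 * Real.exp (γ * t)) +
      Real.exp (γ / 2 * x) * Real.exp (-γ * t) := by
  have hp : Real.exp (-(γ / 2 * x)) * (a ^ 2 * Real.exp (γ * t)) +
      Real.exp (γ / 2 * x) * Real.exp (-γ * t) =
      (|a| * Real.exp (γ / 2 * t - γ / 4 * x)) ^ 2 + (Real.exp (-(γ / 2 * t - γ / 4 * x))) ^ 2 := by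
    rw [mul_pow, sq_abs, ← Real.exp_nat_mul, ← Real.exp_nat_mul, ← Real.exp_add, mul_left_comm,
      ← Real.exp_add]
    push_cast
    ring_nf
  have h1 : Real.exp (γ / 2 * t - γ / 4 * x) * Real.exp (-(γ / 2 * t - γ / 4 * x)) = 1 := by
    rw [← Real.exp_add, add_neg_cancel, Real.exp_zero]
  rw [hp]
  nlinarith [two_mul_le_add_sq (|a| * Real.exp (γ / 2 * t - γ / 4 * x))
    (Real.exp (-(γ / 2 * t - γ / 4 * x))), abs_nonneg a]

section WeightedTail

variable {γ : ℝ} {g : ℝ → ℝ}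

theorem integrableOn_Ioi_of_weighted_sq (hγ : 0 < γ) (hg : Measurable g)
    (hgw : IntegrableOn (fun t => g t ^ 2 * Real.exp (γ * t)) (Ioi 0)) :
    IntegrableOn g (Ioi 0) := by
  refine Integrable.mono' ((hgw.const_mul (Real.exp (-(γ / 2 * 0)))).add
    ((integrableOn_exp_mul_Ioi (neg_lt_zero.2 hγ) 0).const_mul (Real.exp (γ / 2 * 0))))
    hg.aestronglyMeasurable (Eventually.of_forall fun t => ?_)
  exact abs_le_weighted_sq_add_exp γ 0 t (g t)

theorem abs_integral_Ioi_le_exp (hγ : 0 < γ)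
    (hgw : IntegrableOn (fun t => g t ^ 2 * Real.exp (γ * t)) (Ioi 0)) {x : ℝ} (hx : 0 ≤ x) :
    |∫ t in Ioi x, g t| ≤
      ((∫ t in Ioi 0, g t ^ 2 * Real.exp (γ * t)) + γ⁻¹) * Real.exp (-(γ / 2 * x)) := by
  have hsub : Ioi x ⊆ Ioi 0 := Ioi_subset_Ioi hx
  have hA := (hgw.mono_set hsub).const_mul (Real.exp (-(γ / 2 * x)))
  have hB := (integrableOn_exp_mul_Ioi (neg_lt_zero.2 hγ) x).const_mul (Real.exp (γ / 2 * x))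
  have hmono : ∫ t in Ioi x, g t ^ 2 * Real.exp (γ * t) ≤
      ∫ t in Ioi 0, g t ^ 2 * Real.exp (γ * t) :=
    setIntegral_mono_set hgw (Eventually.of_forall fun t => by positivity) hsub.eventuallyLE
  calc |∫ t in Ioi x, g t|
      ≤ ∫ t in Ioi x, (Real.exp (-(γ / 2 * x)) * (g t ^ 2 * Real.exp (γ * t)) +
          Real.exp (γ / 2 * x) * Real.exp (-γ * t)) := by
        rw [← Real.norm_eq_abs]
        exact norm_integral_le_of_norm_le (hA.add hB)
          (Eventually.of_forall fun t => abs_le_weighted_sq_add_exp γ x t (g t))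
    _ = Real.exp (-(γ / 2 * x)) * (∫ t in Ioi x, g t ^ 2 * Real.exp (γ * t)) +
          γ⁻¹ * Real.exp (-(γ / 2 * x)) := by
        rw [integral_add hA hB, integral_const_mul, integral_const_mul,
          integral_exp_mul_Ioi (neg_lt_zero.2 hγ), neg_div_neg_eq, ← mul_div_assoc,
          ← Real.exp_add, div_eq_inv_mul]
        ring_nf
    _ ≤ _ := by
        rw [add_mul, mul_comm (Real.exp _)]
        gcongr

end WeightedTail

/-- If `γ > β > 0` and `h` lies in `H_γ` with weak derivative `g` and `h(∞) = 0`, then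
`∫₀^∞ |h(x)|² e^{βx} dx ≤ ∫_ℝ |(𝓕F)(ξ)|² dξ`, where `F(x) = h(|x|)e^{(β/2)|x|}` is the
even reflection (which lies in `L¹(ℝ) ∩ L²(ℝ)`) and `𝓕F` is its Fourier transform. -/
theorem weighted_L2_le_fourier_L2
    (β γ : ℝ) (hβ : 0 < β) (hβγ : β < γ) (h g : ℝ → ℝ)
    (hg_meas : Measurable g)
    (hg_int : IntegrableOn (fun t => g t ^ 2 * Real.exp (γ * t)) (Set.Ioi 0))
    (hFTC : ∀ x ≥ (0 : ℝ), h x = h 0 + ∫ t in (0:ℝ)..x, g t)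
    (hlim : Tendsto h atTop (nhds 0)) :
    Integrable (fun x : ℝ => h |x| * Real.exp (β / 2 * |x|)) ∧
      Integrable (fun x : ℝ => (h |x| * Real.exp (β / 2 * |x|)) ^ 2) ∧
      (∫ x in Set.Ioi (0:ℝ), h x ^ 2 * Real.exp (β * x))
        ≤ ∫ ξ : ℝ,
            ‖((Real.sqrt (2 * Real.pi) : ℂ))⁻¹ *
                ∫ x : ℝ, (↑(h |x| * Real.exp (β / 2 * |x|)) : ℂ) *
                  Complex.exp (-(Complex.I * ξ * x))‖ ^ 2 := by
  have hγ : 0 < γ := hβ.trans hβγ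
  have hgi : IntegrableOn g (Ioi 0) := integrableOn_Ioi_of_weighted_sq hγ hg_meas hg_int
  have hgii {x : ℝ} (hx : 0 ≤ x) : IntervalIntegrable g volume 0 x :=
    (intervalIntegrable_iff_integrableOn_Ioc_of_le hx).2 (hgi.mono_set Ioc_subset_Ioi_self)
  have htail {x : ℝ} (hx : 0 ≤ x) : h x = -∫ t in Ioi x, g t := by
    have h0 : h 0 + ∫ t in Ioi 0, g t = 0 := by
      refine tendsto_nhds_unique ?_ hlim
      refine ((intervalIntegral_tendsto_integral_Ioi 0 hgi tendsto_id).const_add (h 0)).congr' ?_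
      filter_upwards [eventually_ge_atTop 0] with y hy using (hFTC y hy).symm
    have hsplit := intervalIntegral.integral_interval_add_Ioi hgi
      (hgi.mono_set (Ioi_subset_Ioi hx))
    rw [hFTC x hx]
    linarith
  set C : ℝ := (∫ t in Ioi 0, g t ^ 2 * Real.exp (γ * t)) + γ⁻¹
  have hcont : Continuous fun x : ℝ => h |x| := by
    have hind : Integrable ((Ioi (0 : ℝ)).indicator g) := hgi.integrable_indicator measurableSet_Ioi
    have heq : (fun x : ℝ => h |x|) =
        fun x => h 0 + ∫ t in (0 : ℝ)..|x|, (Ioi (0 : ℝ)).indicator g t := by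
      ext x
      rw [hFTC _ (abs_nonneg x), intervalIntegral.integral_of_le (abs_nonneg x),
        intervalIntegral.integral_of_le (abs_nonneg x)]
      congr 1
      exact setIntegral_congr_fun measurableSet_Ioc fun t ht =>
        (indicator_of_mem (mem_Ioi.2 ht.1) g).symm
    rw [heq]
    exact continuous_const.add
      ((intervalIntegral.continuous_primitive (fun a b => hind.intervalIntegrable) 0).comp
        continuous_abs)
  set F : ℝ → ℝ := fun x => h |x| * Real.exp (β / 2 * |x|) with hF
  have hFc : Continuous F := hcont.mul (by fun_prop)
  have hFle (x : ℝ) : |F x| ≤ C * Real.exp (-((γ - β) / 2) * |x|) := by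
    rw [hF, abs_mul, Real.abs_exp, htail (abs_nonneg x), abs_neg]
    calc _ ≤ C * Real.exp (-(γ / 2 * |x|)) * Real.exp (β / 2 * |x|) := by
          gcongr
          exact abs_integral_Ioi_le_exp hγ hg_int (abs_nonneg x)
      _ = _ := by
          rw [mul_assoc, ← Real.exp_add]
          ring_nf
  have hF1 : Integrable F :=
    ((integrable_exp_neg_mul_abs (by linarith)).const_mul C).mono' hFc.aestronglyMeasurable
      (Eventually.of_forall hFle)
  have hF2 : Integrable fun x => F x ^ 2 := by
    refine ((integrable_exp_neg_mul_abs (sub_pos.2 hβγ)).const_mul (C ^ 2)).mono'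
      (hFc.pow 2).aestronglyMeasurable (Eventually.of_forall fun x => ?_)
    calc ‖F x ^ 2‖ = |F x| ^ 2 := by rw [norm_pow, Real.norm_eq_abs]
      _ ≤ (C * Real.exp (-((γ - β) / 2) * |x|)) ^ 2 := by gcongr; exact hFle x
      _ = C ^ 2 * Real.exp (-(γ - β) * |x|) := by
          rw [mul_pow, ← Real.exp_nat_mul]
          push_cast
          ring_nf
  have hFC2 : MemLp (fun x => (F x : ℂ)) 2 :=
    ((memLp_two_iff_integrable_sq hFc.aestronglyMeasurable).2 hF2).ofReal
  refine ⟨hF1, hF2, ?_⟩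
  have hnonneg : 0 ≤ ∫ x in Ioi (0 : ℝ), h x ^ 2 * Real.exp (β * x) :=
    integral_nonneg fun x => by positivity
  calc ∫ x in Ioi (0 : ℝ), h x ^ 2 * Real.exp (β * x)
      ≤ 2 * ∫ x in Ioi (0 : ℝ), h x ^ 2 * Real.exp (β * x) := by linarith
    _ = ∫ x : ℝ, ‖(F x : ℂ)‖ ^ 2 := by
        rw [← integral_comp_abs (f := fun x => h x ^ 2 * Real.exp (β * x))]
        refine integral_congr_ae (Eventually.of_forall fun x => ?_)
        simp only [hF, Complex.norm_real, Real.norm_eq_abs, sq_abs, mul_pow, ← Real.exp_nat_mul]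
        push_cast
        ring_nf
    _ = _ := (integral_norm_sq_unitary_fourier_eq hF1.ofReal hFC2).symm
end
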